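/- Let Ω ⊂ ℝ² be a bounded domain and let u solve -Δu = f in Ω, u = 0 on ∂Ω, with f ∈ L¹(Ω). Then for every δ ∈ (0, 4π), ∫_Ω exp((4π - δ)|u(x)|/‖f‖₁) dx ≤ (4π²/δ)(diam Ω)², where ‖f‖₁ = ∫_Ω |f|. -/

import Mathlib

open MeasureTheory Real

/-- The Euclidean Laplacian on ℝ² via second derivatives. -/
noncomputable def lap2 (u : EuclideanSpace ℝ (Fin 2) → ℝ) (x : EuclideanSpace ℝ (Fin 2)) : ℝ :=
  iteratedFDeriv ℝ 2 u x ![EuclideanSpace.single 0 1, EuclideanSpace.single 0 1]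
    + iteratedFDeriv ℝ 2 u x ![EuclideanSpace.single 1 1, EuclideanSpace.single 1 1]

/-- A convex `C²` approximation `φ` of the positive part, vanishing on `(-∞, ε]`, with
derivative `ψ` taking values in `[0, 1]`. -/
theorem exists_convex_truncation {ε : ℝ} (hε : 0 < ε) :
    ∃ φ ψ : ℝ → ℝ, (∀ t, HasDerivAt φ (ψ t) t) ∧ ContDiff ℝ 1 ψ ∧ Monotone ψ ∧
      (∀ t, 0 ≤ ψ t) ∧ (∀ t, ψ t ≤ 1) ∧ (∀ t ≤ ε, φ t = 0) ∧ ∀ t, t - 2 * ε ≤ φ t := by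
  set ψ : ℝ → ℝ := fun s => Real.smoothTransition ((s - ε) / ε) with hψ
  have hψ_smooth : ContDiff ℝ 1 ψ :=
    (Real.smoothTransition.contDiff (n := 1)).comp (by fun_prop)
  have hψ_cont : Continuous ψ := hψ_smooth.continuous
  have hψ_int : ∀ a b, IntervalIntegrable ψ volume a b := fun a b =>
    hψ_cont.intervalIntegrable a b
  have hψ_nonneg : ∀ t, 0 ≤ ψ t := fun t => Real.smoothTransition.nonneg _
  have hvanish : ∀ t ≤ ε, ∫ s in (0 : ℝ)..t, ψ s = 0 := by
    intro t ht
    rw [intervalIntegral.integral_congr (g := fun _ => (0 : ℝ))]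
    · simp
    · intro s hs
      have hs' : s ≤ ε := hs.2.trans (sup_le hε.le ht)
      exact Real.smoothTransition.zero_of_nonpos
        (div_nonpos_of_nonpos_of_nonneg (by linarith) hε.le)
  have hnonneg : ∀ t, 0 ≤ ∫ s in (0 : ℝ)..t, ψ s := by
    intro t
    rcases le_total t 0 with ht | ht
    · exact (hvanish t (ht.trans hε.le)).ge
    · exact intervalIntegral.integral_nonneg ht fun s _ => hψ_nonneg s
  refine ⟨fun t => ∫ s in (0 : ℝ)..t, ψ s, ψ, fun t => ?_, hψ_smooth, ?_, hψ_nonneg,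
    fun t => Real.smoothTransition.le_one _, hvanish, fun t => ?_⟩
  · exact intervalIntegral.integral_hasDerivAt_right (hψ_int _ _)
      hψ_cont.aestronglyMeasurable.stronglyMeasurableAtFilter hψ_cont.continuousAt
  · intro a b hab
    exact Real.smoothTransition.monotone (by gcongr)
  · rcases le_total t (2 * ε) with ht | ht
    · linarith [hnonneg t]
    · have hsplit := intervalIntegral.integral_add_adjacent_intervals
        (hψ_int 0 (2 * ε)) (hψ_int (2 * ε) t)
      have hone : ∫ s in (2 * ε)..t, ψ s = t - 2 * ε := by
        rw [intervalIntegral.integral_congr (g := fun _ => (1 : ℝ))]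
        · simp
        · intro s hs
          rw [Set.uIcc_of_le ht] at hs
          exact Real.smoothTransition.one_of_one_le ((one_le_div hε).2 (by linarith [hs.1]))
      dsimp only
      linarith [hnonneg (2 * ε)]

section SecondDerivatives

variable {E : Type*} [NormedAddCommGroup E] [NormedSpace ℝ E]

theorem fderiv_fderiv_apply_eq_iteratedFDeriv {u : E → ℝ} {x : E} (hu : ContDiffAt ℝ 2 u x)
    (e : E) : fderiv ℝ (fun y => fderiv ℝ u y e) x e = iteratedFDeriv ℝ 2 u x ![e, e] := by
  have hd : DifferentiableAt ℝ (fderiv ℝ u) x :=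
    (hu.fderiv_right (m := 1) (by norm_num)).differentiableAt (by norm_num)
  rw [iteratedFDeriv_two_apply, fderiv_clm_apply hd (differentiableAt_const e)]
  simp

theorem iteratedFDeriv_two_comp_apply {φ ψ : ℝ → ℝ} (hφ : ∀ t, HasDerivAt φ (ψ t) t)
    (hψ : ContDiff ℝ 1 ψ) {u : E → ℝ} {x : E} (hu : ContDiffAt ℝ 2 u x) (e : E) :
    iteratedFDeriv ℝ 2 (φ ∘ u) x ![e, e] =
      deriv ψ (u x) * fderiv ℝ u x e ^ 2 + ψ (u x) * iteratedFDeriv ℝ 2 u x ![e, e] := by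
  have hd : DifferentiableAt ℝ (fderiv ℝ u) x :=
    (hu.fderiv_right (m := 1) (by norm_num)).differentiableAt (by norm_num)
  have hfst : fderiv ℝ (φ ∘ u) =ᶠ[nhds x] fun y => ψ (u y) • fderiv ℝ u y := by
    filter_upwards [hu.eventually (by simp)] with y hy
    exact ((hφ (u y)).comp_hasFDerivAt y (hy.differentiableAt (by norm_num)).hasFDerivAt).fderiv
  have hψu : HasFDerivAt (fun y => ψ (u y)) (deriv ψ (u x) • fderiv ℝ u x) x :=
    ((hψ.differentiable (by norm_num) (u x)).hasDerivAt).comp_hasFDerivAt x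
      (hu.differentiableAt (by norm_num)).hasFDerivAt
  rw [iteratedFDeriv_two_apply, iteratedFDeriv_two_apply, hfst.fderiv_eq,
    (hψu.fun_smul hd.hasFDerivAt).fderiv]
  simp
  ring

theorem contDiff_two_of_hasDerivAt {φ ψ : ℝ → ℝ} (hφ : ∀ t, HasDerivAt φ (ψ t) t)
    (hψ : ContDiff ℝ 1 ψ) : ContDiff ℝ 2 φ := by
  have hderiv : deriv φ = ψ := funext fun t => (hφ t).deriv
  rw [show (2 : WithTop ℕ∞) = 1 + 1 by norm_num, contDiff_succ_iff_deriv]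
  exact ⟨fun t => (hφ t).differentiableAt, by simp, by rwa [hderiv]⟩

/-- Two integrations by parts in the direction `e` against a compactly supported function. -/
theorem integral_mul_iteratedFDeriv_two [MeasurableSpace E] [BorelSpace E]
    [FiniteDimensional ℝ E] (μ : Measure E) [μ.IsAddHaarMeasure] {G v : E → ℝ}
    (hG : ContDiff ℝ 2 G) (hv : ContDiff ℝ 2 v) (hvs : HasCompactSupport v) (e : E) :
    ∫ y, G y * iteratedFDeriv ℝ 2 v y ![e, e] ∂μ =
      ∫ y, iteratedFDeriv ℝ 2 G y ![e, e] * v y ∂μ := by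
  have hG' : ContDiff ℝ 1 fun y => fderiv ℝ G y e :=
    (hG.fderiv_right (m := 1) (by norm_num)).clm_apply contDiff_const
  have hv' : ContDiff ℝ 1 fun y => fderiv ℝ v y e :=
    (hv.fderiv_right (m := 1) (by norm_num)).clm_apply contDiff_const
  have hvs' : HasCompactSupport fun y => fderiv ℝ v y e := hvs.fderiv_apply ℝ e
  have hvs'' : HasCompactSupport fun y => fderiv ℝ (fun z => fderiv ℝ v z e) y e :=
    hvs'.fderiv_apply ℝ e
  have hG'' : Continuous fun y => fderiv ℝ (fun z => fderiv ℝ G z e) y e :=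
    (hG'.continuous_fderiv (by norm_num)).clm_apply continuous_const
  have hv'' : Continuous fun y => fderiv ℝ (fun z => fderiv ℝ v z e) y e :=
    (hv'.continuous_fderiv (by norm_num)).clm_apply continuous_const
  have hGd : Differentiable ℝ G := hG.differentiable (by norm_num)
  have hvd : Differentiable ℝ v := hv.differentiable (by norm_num)
  have hGd' := hG'.differentiable (by norm_num)
  have hvd' := hv'.differentiable (by norm_num)
  simp_rw [← fderiv_fderiv_apply_eq_iteratedFDeriv hv.contDiffAt,
    ← fderiv_fderiv_apply_eq_iteratedFDeriv hG.contDiffAt]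
  have first := integral_mul_fderiv_eq_neg_fderiv_mul_of_integrable (μ := μ) (f := G)
    (g := fun y => fderiv ℝ v y e) (v := e)
    ((hG'.continuous.mul hv'.continuous).integrable_of_hasCompactSupport hvs'.mul_left)
    ((hG.continuous.mul hv'').integrable_of_hasCompactSupport hvs''.mul_left)
    ((hG.continuous.mul hv'.continuous).integrable_of_hasCompactSupport hvs'.mul_left)
    (fun y _ => hGd y) (fun y _ => hvd' y)
  have second := integral_mul_fderiv_eq_neg_fderiv_mul_of_integrable (μ := μ)
    (f := fun y => fderiv ℝ G y e) (g := v) (v := e)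
    ((hG''.mul hv.continuous).integrable_of_hasCompactSupport hvs.mul_left)
    ((hG'.continuous.mul hv'.continuous).integrable_of_hasCompactSupport hvs'.mul_left)
    ((hG'.continuous.mul hv.continuous).integrable_of_hasCompactSupport hvs.mul_left)
    (fun y _ => hGd' y) (fun y _ => hvd y)
  rw [first, second, neg_neg]

end SecondDerivatives

/-- A smooth regularization of the kernel `log (d / ‖y - x‖)`, recovered as `c → ∞`. -/
noncomputable def regLog (c d : ℝ) (x y : EuclideanSpace ℝ (Fin 2)) : ℝ :=
  1 / 2 * (Real.log (1 + c ^ 2 * d ^ 2) - Real.log (1 + c ^ 2 * ‖y - x‖ ^ 2))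

theorem regLog_arg_pos (c : ℝ) (x y : EuclideanSpace ℝ (Fin 2)) :
    0 < 1 + c ^ 2 * ‖y - x‖ ^ 2 := by positivity

theorem contDiff_regLog (c d : ℝ) (x : EuclideanSpace ℝ (Fin 2)) {n : WithTop ℕ∞} :
    ContDiff ℝ n (regLog c d x) := by
  refine contDiff_const.mul
    (contDiff_const.sub (ContDiff.log ?_ fun y => (regLog_arg_pos c x y).ne'))
  exact contDiff_const.add (contDiff_const.mul ((contDiff_id.sub contDiff_const).norm_sq ℝ))

theorem iteratedFDeriv_two_regLog (c d : ℝ) (x y e : EuclideanSpace ℝ (Fin 2)) :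
    iteratedFDeriv ℝ 2 (regLog c d x) y ![e, e] =
      -(c ^ 2 * ‖e‖ ^ 2) / (1 + c ^ 2 * ‖y - x‖ ^ 2)
        + 2 * c ^ 4 * inner ℝ (y - x) e ^ 2 / (1 + c ^ 2 * ‖y - x‖ ^ 2) ^ 2 := by
  have hq : ∀ z, HasFDerivAt (fun z : EuclideanSpace ℝ (Fin 2) => 1 + c ^ 2 * ‖z - x‖ ^ 2)
      (c ^ 2 • (2 • innerSL ℝ (z - x))) z := by
    intro z
    have h := ((hasFDerivAt_id (𝕜 := ℝ) z).sub_const x).norm_sq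
    simpa using (h.const_mul (c ^ 2)).const_add 1
  have hfst : (fun z => fderiv ℝ (regLog c d x) z e) =
      fun z => -(c ^ 2 * inner ℝ (z - x) e) / (1 + c ^ 2 * ‖z - x‖ ^ 2) := by
    funext z
    have h := (((hq z).log (regLog_arg_pos c x z).ne').const_sub
      (Real.log (1 + c ^ 2 * d ^ 2))).const_mul (1 / 2)
    have h' : fderiv ℝ (regLog c d x) z = _ := h.fderiv
    rw [h']
    simp [-map_sub]
    ring
  rw [← fderiv_fderiv_apply_eq_iteratedFDeriv (contDiff_regLog c d x).contDiffAt, hfst]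
  have hin : HasFDerivAt (fun z => -(c ^ 2 * inner ℝ (z - x) e)) (-(c ^ 2 • innerSL ℝ e)) y := by
    have h := (((innerSL ℝ e).hasFDerivAt.comp y
      ((hasFDerivAt_id (𝕜 := ℝ) y).sub_const x)).const_mul (c ^ 2)).fun_neg
    simpa [Function.comp_def, real_inner_comm, -map_sub] using h
  have hpos := regLog_arg_pos c x y
  have h := hin.mul ((hasDerivAt_inv hpos.ne').comp_hasFDerivAt y (hq y))
  have heq : (fun z => -(c ^ 2 * inner ℝ (z - x) e) / (1 + c ^ 2 * ‖z - x‖ ^ 2)) =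
      (fun z => -(c ^ 2 * inner ℝ (z - x) e)) *
        (Inv.inv ∘ fun z => 1 + c ^ 2 * ‖z - x‖ ^ 2) := by
    funext z
    simp [div_eq_mul_inv]
  rw [heq, h.fderiv]
  simp [-map_sub]
  field_simp
  ring

theorem lap2_regLog (c d : ℝ) (x y : EuclideanSpace ℝ (Fin 2)) :
    lap2 (regLog c d x) y = -(2 * c ^ 2 / (1 + c ^ 2 * ‖y - x‖ ^ 2) ^ 2) := by
  have hpos := regLog_arg_pos c x y
  have hr : ‖y - x‖ ^ 2 = inner ℝ (y - x) (EuclideanSpace.single 0 (1 : ℝ)) ^ 2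
      + inner ℝ (y - x) (EuclideanSpace.single 1 (1 : ℝ)) ^ 2 := by
    simp [EuclideanSpace.norm_sq_eq, EuclideanSpace.inner_single_right]
  have hsum : 2 * c ^ 4 * ‖y - x‖ ^ 2 = 2 * c ^ 2 * ((1 + c ^ 2 * ‖y - x‖ ^ 2) - 1) := by ring
  rw [lap2, iteratedFDeriv_two_regLog, iteratedFDeriv_two_regLog]
  have h0 : ‖(EuclideanSpace.single 0 (1 : ℝ) : EuclideanSpace ℝ (Fin 2))‖ = 1 := by simp
  have h1 : ‖(EuclideanSpace.single 1 (1 : ℝ) : EuclideanSpace ℝ (Fin 2))‖ = 1 := by simp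
  rw [h0, h1]
  rw [show ∀ a b₁ b₂ q q2 : ℝ, a / q + 2 * c ^ 4 * b₁ / q2 + (a / q + 2 * c ^ 4 * b₂ / q2)
    = 2 * a / q + 2 * c ^ 4 * (b₁ + b₂) / q2 from fun a b₁ b₂ q q2 => by ring, ← hr, hsum]
  field_simp
  ring

theorem lap2_neg (u : EuclideanSpace ℝ (Fin 2) → ℝ) (x : EuclideanSpace ℝ (Fin 2)) :
    lap2 (-u) x = -lap2 u x := by
  simp only [lap2, iteratedFDeriv_neg_apply, neg_apply]
  ring

theorem continuous_iteratedFDeriv_two_apply {v : EuclideanSpace ℝ (Fin 2) → ℝ}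
    (hv : ContDiff ℝ 2 v) (e : EuclideanSpace ℝ (Fin 2)) :
    Continuous fun y => iteratedFDeriv ℝ 2 v y ![e, e] := by
  have h : Continuous (iteratedFDeriv ℝ 2 v) := hv.continuous_iteratedFDeriv (by norm_num)
  exact (ContinuousMultilinearMap.apply ℝ (fun _ : Fin 2 => EuclideanSpace ℝ (Fin 2)) ℝ
    ![e, e]).continuous.comp h

theorem continuous_lap2 {v : EuclideanSpace ℝ (Fin 2) → ℝ} (hv : ContDiff ℝ 2 v) :
    Continuous (lap2 v) :=
  (continuous_iteratedFDeriv_two_apply hv _).add (continuous_iteratedFDeriv_two_apply hv _)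

theorem tsupport_lap2_subset (v : EuclideanSpace ℝ (Fin 2) → ℝ) :
    tsupport (lap2 v) ⊆ tsupport v := by
  refine closure_minimal (fun x hx => ?_) (isClosed_tsupport v)
  refine support_iteratedFDeriv_subset (𝕜 := ℝ) 2 fun h => hx ?_
  simp [lap2, h]

theorem hasCompactSupport_iteratedFDeriv_two_apply {v : EuclideanSpace ℝ (Fin 2) → ℝ}
    (hvs : HasCompactSupport v) (e : EuclideanSpace ℝ (Fin 2)) :
    HasCompactSupport fun y => iteratedFDeriv ℝ 2 v y ![e, e] := by
  refine hvs.mono' fun y hy => support_iteratedFDeriv_subset (𝕜 := ℝ) 2 fun h => hy ?_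
  simp [h]

/-- Green's identity against a compactly supported function. -/
theorem integral_mul_lap2 {G v : EuclideanSpace ℝ (Fin 2) → ℝ}
    (hG : ContDiff ℝ 2 G) (hv : ContDiff ℝ 2 v) (hvs : HasCompactSupport v) :
    ∫ y, G y * lap2 v y = ∫ y, lap2 G y * v y := by
  have hleft : ∀ e, Integrable fun y => G y * iteratedFDeriv ℝ 2 v y ![e, e] := fun e =>
    (hG.continuous.mul
      (continuous_iteratedFDeriv_two_apply hv e)).integrable_of_hasCompactSupport
        (hasCompactSupport_iteratedFDeriv_two_apply hvs e).mul_left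
  have hright : ∀ e, Integrable fun y => iteratedFDeriv ℝ 2 G y ![e, e] * v y := fun e =>
    ((continuous_iteratedFDeriv_two_apply hG e).mul
      hv.continuous).integrable_of_hasCompactSupport hvs.mul_left
  have hparts := integral_mul_iteratedFDeriv_two volume hG hv hvs
  calc ∫ y, G y * lap2 v y
      = ∫ y, (G y * iteratedFDeriv ℝ 2 v y
            ![EuclideanSpace.single 0 1, EuclideanSpace.single 0 1]
          + G y * iteratedFDeriv ℝ 2 v y
            ![EuclideanSpace.single 1 1, EuclideanSpace.single 1 1]) := by
        simp only [lap2, mul_add]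
    _ = ∫ y, (iteratedFDeriv ℝ 2 G y
            ![EuclideanSpace.single 0 1, EuclideanSpace.single 0 1] * v y
          + iteratedFDeriv ℝ 2 G y
            ![EuclideanSpace.single 1 1, EuclideanSpace.single 1 1] * v y) := by
        rw [integral_add (hleft (EuclideanSpace.single 0 1)) (hleft (EuclideanSpace.single 1 1)),
          integral_add (hright (EuclideanSpace.single 0 1)) (hright (EuclideanSpace.single 1 1)),
          hparts (EuclideanSpace.single 0 1), hparts (EuclideanSpace.single 1 1)]
    _ = ∫ y, lap2 G y * v y := by
        simp only [lap2, add_mul]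

/-- A truncation of `u` that is compactly supported in `Ω` and whose negative Laplacian is
controlled by that of `u`. -/
theorem exists_compactly_supported_truncation {Ω : Set (EuclideanSpace ℝ (Fin 2))}
    (hΩo : IsOpen Ω) (hΩb : Bornology.IsBounded Ω) {u : EuclideanSpace ℝ (Fin 2) → ℝ}
    (hu : ContDiffOn ℝ 2 u Ω) (hcont : ContinuousOn u (closure Ω))
    (hbd : ∀ x ∈ frontier Ω, u x = 0) {ε : ℝ} (hε : 0 < ε) :
    ∃ v : EuclideanSpace ℝ (Fin 2) → ℝ, ContDiff ℝ 2 v ∧ HasCompactSupport v ∧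
      tsupport v ⊆ Ω ∧ (∀ x ∈ Ω, -lap2 v x ≤ |lap2 u x|) ∧ ∀ x ∈ Ω, u x - 2 * ε ≤ v x := by
  obtain ⟨φ, ψ, hφ, hψ, hmono, hψ0, hψ1, hvanish, hlow⟩ := exists_convex_truncation hε
  set K : Set (EuclideanSpace ℝ (Fin 2)) := closure Ω ∩ u ⁻¹' Set.Ici ε with hK
  have hKclosed : IsClosed K :=
    hcont.preimage_isClosed_of_isClosed isClosed_closure isClosed_Ici
  have hKcompact : IsCompact K :=
    hΩb.isCompact_closure.of_isClosed_subset hKclosed Set.inter_subset_left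
  have hKΩ : K ⊆ Ω := by
    rintro x ⟨hx, hux⟩
    by_contra hxΩ
    have hfr : x ∈ frontier Ω := ⟨hx, by rwa [hΩo.interior_eq]⟩
    have : ε ≤ u x := hux
    linarith [hbd x hfr]
  have hsupp : Function.support (Ω.indicator (φ ∘ u)) ⊆ K := by
    intro x hx
    have hxΩ : x ∈ Ω := by
      by_contra h
      exact hx (Set.indicator_of_notMem h _)
    refine ⟨subset_closure hxΩ, ?_⟩
    by_contra h
    refine hx ?_
    rw [Set.indicator_of_mem hxΩ]
    exact hvanish _ (not_le.1 h).le
  have htsupp : tsupport (Ω.indicator (φ ∘ u)) ⊆ K := closure_minimal hsupp hKclosed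
  have heq : ∀ x ∈ Ω, Ω.indicator (φ ∘ u) =ᶠ[nhds x] φ ∘ u := fun x hx => by
    filter_upwards [hΩo.mem_nhds hx] with y hy
    exact Set.indicator_of_mem hy _
  have huat : ∀ x ∈ Ω, ContDiffAt ℝ 2 u x := fun x hx => hu.contDiffAt (hΩo.mem_nhds hx)
  refine ⟨Ω.indicator (φ ∘ u), ?_, hKcompact.of_isClosed_subset (isClosed_tsupport _) htsupp,
    htsupp.trans hKΩ, fun x hx => ?_, fun x hx => ?_⟩
  · rw [contDiff_iff_contDiffAt]
    intro x
    by_cases hx : x ∈ Ω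
    · exact ((contDiff_two_of_hasDerivAt hφ hψ).contDiffAt.comp x (huat x hx)).congr_of_eventuallyEq
        (heq x hx)
    · have hxt : x ∉ tsupport (Ω.indicator (φ ∘ u)) := fun h => hx (hKΩ (htsupp h))
      exact contDiffAt_const.congr_of_eventuallyEq (notMem_tsupport_iff_eventuallyEq.1 hxt)
  · have hψ' : 0 ≤ deriv ψ (u x) := hmono.deriv_nonneg
    have hlap : lap2 (Ω.indicator (φ ∘ u)) x =
        deriv ψ (u x) * (fderiv ℝ u x (EuclideanSpace.single 0 1) ^ 2
          + fderiv ℝ u x (EuclideanSpace.single 1 1) ^ 2) + ψ (u x) * lap2 u x := by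
      rw [lap2, ((heq x hx).iteratedFDeriv ℝ 2).eq_of_nhds,
        iteratedFDeriv_two_comp_apply hφ hψ (huat x hx),
        iteratedFDeriv_two_comp_apply hφ hψ (huat x hx), lap2]
      ring
    have hgrad : 0 ≤ deriv ψ (u x) * (fderiv ℝ u x (EuclideanSpace.single 0 1) ^ 2
          + fderiv ℝ u x (EuclideanSpace.single 1 1) ^ 2) := by positivity
    have hmul : -(ψ (u x) * lap2 u x) ≤ |lap2 u x| :=
      calc -(ψ (u x) * lap2 u x) ≤ |ψ (u x) * lap2 u x| := neg_le_abs _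
        _ = ψ (u x) * |lap2 u x| := by rw [abs_mul, abs_of_nonneg (hψ0 _)]
        _ ≤ |lap2 u x| := mul_le_of_le_one_left (abs_nonneg _) (hψ1 _)
    rw [hlap]
    linarith
  · rw [Set.indicator_of_mem hx]
    exact hlow _

theorem regLog_nonneg {c d : ℝ} {x y : EuclideanSpace ℝ (Fin 2)} (hy : ‖y - x‖ ≤ d) :
    0 ≤ regLog c d x y := by
  have h : Real.log (1 + c ^ 2 * ‖y - x‖ ^ 2) ≤ Real.log (1 + c ^ 2 * d ^ 2) :=
    Real.log_le_log (regLog_arg_pos c x y) (by gcongr)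
  unfold regLog
  linarith

theorem regLog_le (c d : ℝ) (x y : EuclideanSpace ℝ (Fin 2)) :
    regLog c d x y ≤ 1 / 2 * Real.log (1 + c ^ 2 * d ^ 2) := by
  have h : 0 ≤ Real.log (1 + c ^ 2 * ‖y - x‖ ^ 2) :=
    Real.log_nonneg (le_add_of_nonneg_right (by positivity))
  unfold regLog
  linarith

theorem regLog_le_log {c d : ℝ} {x y : EuclideanSpace ℝ (Fin 2)} (hy : ‖y - x‖ ≤ d)
    (hxy : 0 < ‖y - x‖) : regLog c d x y ≤ Real.log (d / ‖y - x‖) := by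
  have hd : 0 < d := hxy.trans_le hy
  have h : Real.log ((1 + c ^ 2 * d ^ 2) * ‖y - x‖ ^ 2)
      ≤ Real.log ((1 + c ^ 2 * ‖y - x‖ ^ 2) * d ^ 2) := by
    refine Real.log_le_log (by positivity) ?_
    have : ‖y - x‖ ^ 2 ≤ d ^ 2 := by gcongr
    linarith
  rw [Real.log_mul (by positivity) (by positivity), Real.log_mul (by positivity) (by positivity),
    Real.log_pow, Real.log_pow] at h
  rw [Real.log_div hd.ne' hxy.ne', regLog]
  push_cast at h
  linarith

theorem exp_mul_regLog_le {a c d : ℝ} (ha : 0 ≤ a) {x y : EuclideanSpace ℝ (Fin 2)}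
    (hy : ‖y - x‖ ≤ d) (hxy : 0 < ‖y - x‖) :
    Real.exp (a * regLog c d x y) ≤ (d / ‖y - x‖) ^ a := by
  rw [Real.rpow_def_of_pos (div_pos (hxy.trans_le hy) hxy), mul_comm a]
  gcongr
  exact regLog_le_log hy hxy

/-- A bounded continuous weight on `Ω` preserves integrability. -/
theorem integrableOn_mul_of_bounded {Ω : Set (EuclideanSpace ℝ (Fin 2))} (hΩ : MeasurableSet Ω)
    {G f : EuclideanSpace ℝ (Fin 2) → ℝ} (hG : Continuous G) {C : ℝ}
    (hGC : ∀ y ∈ Ω, |G y| ≤ C) (hf : IntegrableOn f Ω) :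
    IntegrableOn (fun y => G y * f y) Ω :=
  Integrable.bdd_mul (c := C) hf hG.aestronglyMeasurable
    (ae_restrict_of_forall_mem hΩ hGC)

theorem integral_kernel_mul_le {Ω : Set (EuclideanSpace ℝ (Fin 2))} (hΩo : IsOpen Ω)
    {f v : EuclideanSpace ℝ (Fin 2) → ℝ} (hf : IntegrableOn f Ω) (hv : ContDiff ℝ 2 v)
    (hvs : HasCompactSupport v) (hvΩ : tsupport v ⊆ Ω) (hvf : ∀ y ∈ Ω, -lap2 v y ≤ |f y|)
    {d : ℝ} {x : EuclideanSpace ℝ (Fin 2)} (hd : ∀ y ∈ Ω, ‖y - x‖ ≤ d) (c : ℝ) :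
    ∫ y, 2 * c ^ 2 / (1 + c ^ 2 * ‖y - x‖ ^ 2) ^ 2 * v y ≤ ∫ y in Ω, regLog c d x y * |f y| := by
  have hG : ContDiff ℝ 2 (regLog c d x) := contDiff_regLog c d x
  have hlapvs : HasCompactSupport (lap2 v) :=
    hvs.of_isClosed_subset (isClosed_tsupport _) (tsupport_lap2_subset v)
  have hsupp : Function.support (fun y => regLog c d x y * -lap2 v y) ⊆ Ω := by
    intro y hy
    refine hvΩ (tsupport_lap2_subset v (subset_tsupport _ fun h => hy ?_))
    simp [h]
  calc ∫ y, 2 * c ^ 2 / (1 + c ^ 2 * ‖y - x‖ ^ 2) ^ 2 * v y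
      = -∫ y, lap2 (regLog c d x) y * v y := by
        rw [← integral_neg]
        simp only [lap2_regLog, neg_mul, neg_neg]
    _ = ∫ y, regLog c d x y * -lap2 v y := by
        rw [← integral_mul_lap2 hG hv hvs, ← integral_neg]
        simp only [mul_neg]
    _ = ∫ y in Ω, regLog c d x y * -lap2 v y :=
        (setIntegral_eq_integral_of_forall_compl_eq_zero fun y hy =>
          Function.notMem_support.1 fun h => hy (hsupp h)).symm
    _ ≤ ∫ y in Ω, regLog c d x y * |f y| := by
        refine setIntegral_mono_on ?_ ?_ hΩo.measurableSet fun y hy => ?_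
        · exact ((hG.continuous.mul (continuous_lap2 hv).neg).integrable_of_hasCompactSupport
            hlapvs.neg.mul_left).integrableOn
        · refine integrableOn_mul_of_bounded (C := 1 / 2 * Real.log (1 + c ^ 2 * d ^ 2))
            hΩo.measurableSet hG.continuous (fun y hy => ?_) hf.abs
          rw [abs_of_nonneg (regLog_nonneg (hd y hy))]
          exact regLog_le c d x y
        · exact mul_le_mul_of_nonneg_left (hvf y hy) (regLog_nonneg (hd y hy))

/-- Jensen's inequality for the exponential and a nonnegative weight. -/
theorem exp_integral_div_le {α : Type*} [MeasurableSpace α] {μ : Measure α} {g h : α → ℝ}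
    (hg : Integrable g μ) (hg0 : ∀ y, 0 ≤ g y) (hpos : 0 < ∫ y, g y ∂μ)
    (hhg : Integrable (fun y => h y * g y) μ)
    (hexp : Integrable (fun y => Real.exp (h y) * g y) μ) :
    Real.exp ((∫ y, h y * g y ∂μ) / ∫ y, g y ∂μ) ≤
      (∫ y, Real.exp (h y) * g y ∂μ) / ∫ y, g y ∂μ := by
  set m := (∫ y, h y * g y ∂μ) / ∫ y, g y ∂μ with hm
  have hmF : m * ∫ y, g y ∂μ = ∫ y, h y * g y ∂μ := div_mul_cancel₀ _ hpos.ne'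
  have htangent : ∫ y, Real.exp m * (h y * g y + (1 - m) * g y) ∂μ
      ≤ ∫ y, Real.exp (h y) * g y ∂μ := by
    refine integral_mono ((hhg.add (hg.const_mul _)).const_mul _) hexp fun y => ?_
    have hle : Real.exp m * (h y - m + 1) ≤ Real.exp (h y) := by
      calc Real.exp m * (h y - m + 1) ≤ Real.exp m * Real.exp (h y - m) := by
            gcongr
            exact Real.add_one_le_exp _
        _ = Real.exp (h y) := by rw [← Real.exp_add]; ring_nf
    have := mul_le_mul_of_nonneg_right hle (hg0 y)
    dsimp only
    linarith
  rw [integral_const_mul, integral_add hhg (hg.const_mul _), integral_const_mul, ← hmF] at htangent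
  rw [le_div_iff₀ hpos]
  linarith

theorem volume_real_unit_ball_fin_two :
    volume.real (Metric.ball (0 : EuclideanSpace ℝ (Fin 2)) 1) = π := by
  simp [Measure.real, EuclideanSpace.volume_ball_fin_two, Real.pi_pos.le]

theorem integral_inv_one_add_norm_sq_sq :
    ∫ z : EuclideanSpace ℝ (Fin 2), 1 / π / (1 + ‖z‖ ^ 2) ^ 2 = 1 := by
  have hderiv : ∀ r ∈ Set.Ici (0 : ℝ), HasDerivAt (fun r : ℝ => -(1 / (2 * π)) * (1 + r ^ 2)⁻¹)
      (r * (1 / π / (1 + r ^ 2) ^ 2)) r := by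
    intro r _
    have h := (((hasDerivAt_pow 2 r).const_add 1).inv
      (by positivity : (1 + r ^ 2 : ℝ) ≠ 0)).const_mul (-(1 / (2 * π)))
    refine h.congr_deriv ?_
    have := Real.pi_pos.ne'
    field_simp
    norm_num
  have hlim : Filter.Tendsto (fun r : ℝ => -(1 / (2 * π)) * (1 + r ^ 2)⁻¹) Filter.atTop
      (nhds (-(1 / (2 * π)) * 0)) :=
    (tendsto_inv_atTop_zero.comp (Filter.tendsto_atTop_add_const_left _ _
      (Filter.tendsto_pow_atTop (by norm_num)))).const_mul _
  have hint := integral_Ioi_of_hasDerivAt_of_nonneg' hderiv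
    (fun r (hr : 0 < r) => by have := Real.pi_pos; positivity) hlim
  rw [integral_fun_norm_addHaar volume (fun r => 1 / π / (1 + r ^ 2) ^ 2),
    volume_real_unit_ball_fin_two]
  simp only [finrank_euclideanSpace, Fintype.card_fin, smul_eq_mul, Nat.add_one_sub_one, pow_one,
    nsmul_eq_mul]
  rw [hint]
  have := Real.pi_pos.ne'
  field_simp
  norm_num

theorem tendsto_integral_kernel_mul {v : EuclideanSpace ℝ (Fin 2) → ℝ} (hv : Continuous v)
    (hvs : HasCompactSupport v) (x : EuclideanSpace ℝ (Fin 2)) :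
    Filter.Tendsto (fun c : ℝ => ∫ y, 2 * c ^ 2 / (1 + c ^ 2 * ‖y - x‖ ^ 2) ^ 2 * v y)
      Filter.atTop (nhds (2 * π * v x)) := by
  have hdecay : Filter.Tendsto (fun z : EuclideanSpace ℝ (Fin 2) =>
      ‖z‖ ^ Module.finrank ℝ (EuclideanSpace ℝ (Fin 2)) * (1 / π / (1 + ‖z‖ ^ 2) ^ 2))
      (Bornology.cobounded _) (nhds 0) := by
    have hsq : Filter.Tendsto (fun z : EuclideanSpace ℝ (Fin 2) => 1 + ‖z‖ ^ 2)
        (Bornology.cobounded _) Filter.atTop :=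
      Filter.tendsto_atTop_add_const_left _ _
        ((Filter.tendsto_pow_atTop (by norm_num)).comp tendsto_norm_cobounded_atTop)
    have hinv := ((tendsto_inv_atTop_zero.comp hsq).const_mul (1 / π))
    rw [mul_zero] at hinv
    refine squeeze_zero (fun z => by have := Real.pi_pos; positivity) (fun z => ?_) hinv
    have := Real.pi_pos
    simp only [finrank_euclideanSpace, Fintype.card_fin, Function.comp_apply]
    rw [← div_eq_mul_inv, ← mul_div_assoc, div_le_div_iff₀ (by positivity) (by positivity)]
    have h : 0 ≤ 1 / π * (1 + ‖z‖ ^ 2) := by positivity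
    linarith
  have hpeak := (tendsto_integral_comp_smul_smul_of_integrable'
    (φ := fun z : EuclideanSpace ℝ (Fin 2) => 1 / π / (1 + ‖z‖ ^ 2) ^ 2) (μ := volume)
    (fun z => by have := Real.pi_pos; positivity) integral_inv_one_add_norm_sq_sq hdecay
    (x₀ := x) (hv.integrable_of_hasCompactSupport hvs) hv.continuousAt).const_mul (2 * π)
  refine hpeak.congr fun c => ?_
  rw [← integral_const_mul]
  congr 1
  funext y
  have := Real.pi_pos.ne'
  simp only [finrank_euclideanSpace, Fintype.card_fin, smul_eq_mul, norm_smul, mul_pow,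
    Real.norm_eq_abs, sq_abs, norm_sub_rev x y]
  field_simp

/-- Exponential bound on a compactly supported function by the potential of its Laplacian. -/
theorem ofReal_exp_le_lintegral {Ω : Set (EuclideanSpace ℝ (Fin 2))} (hΩo : IsOpen Ω)
    {f v : EuclideanSpace ℝ (Fin 2) → ℝ} (hf : IntegrableOn f Ω)
    (hF : 0 < ∫ y in Ω, |f y|) (hv : ContDiff ℝ 2 v)
    (hvs : HasCompactSupport v) (hvΩ : tsupport v ⊆ Ω) (hvf : ∀ y ∈ Ω, -lap2 v y ≤ |f y|)
    {a d : ℝ} (ha : 0 ≤ a) {x : EuclideanSpace ℝ (Fin 2)} (hd : ∀ y ∈ Ω, ‖y - x‖ ≤ d) :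
    ENNReal.ofReal (Real.exp (a * (2 * π * v x) / ∫ y in Ω, |f y|)) ≤
      ∫⁻ y in Ω, ENNReal.ofReal ((d / ‖y - x‖) ^ a)
        * ENNReal.ofReal (|f y| / ∫ z in Ω, |f z|) := by
  set F := ∫ y in Ω, |f y| with hFdef
  have hlim := ((tendsto_integral_kernel_mul hv.continuous hvs x).const_mul a).div_const F
  have hlim' := (ENNReal.continuous_ofReal.tendsto _).comp
    ((Real.continuous_exp.tendsto _).comp hlim)
  refine le_of_tendsto' hlim' fun c => ?_
  set C := 1 / 2 * Real.log (1 + c ^ 2 * d ^ 2)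
  have hGcont : Continuous (regLog c d x) := (contDiff_regLog c d x (n := 0)).continuous
  have hG0 : ∀ y ∈ Ω, 0 ≤ a * regLog c d x y := fun y hy =>
    mul_nonneg ha (regLog_nonneg (hd y hy))
  have hGC : ∀ y, a * regLog c d x y ≤ a * C := fun y =>
    mul_le_mul_of_nonneg_left (regLog_le c d x y) ha
  have hlin : IntegrableOn (fun y => a * regLog c d x y * |f y|) Ω :=
    integrableOn_mul_of_bounded (C := a * C) hΩo.measurableSet (hGcont.const_mul a)
      (fun y hy => by rw [abs_of_nonneg (hG0 y hy)]; exact hGC y) hf.abs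
  have hexp : IntegrableOn (fun y => Real.exp (a * regLog c d x y) * |f y|) Ω :=
    integrableOn_mul_of_bounded (C := Real.exp (a * C)) hΩo.measurableSet
      (Real.continuous_exp.comp (hGcont.const_mul a))
      (fun y _ => by rw [Real.abs_exp]; exact Real.exp_le_exp.2 (hGC y)) hf.abs
  have hjensen := exp_integral_div_le hf.abs (fun y => abs_nonneg (f y)) hF hlin hexp
  have hkernel : a * ∫ y, 2 * c ^ 2 / (1 + c ^ 2 * ‖y - x‖ ^ 2) ^ 2 * v y
      ≤ ∫ y in Ω, a * regLog c d x y * |f y| := by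
    simp only [mul_assoc a]
    rw [integral_const_mul]
    exact mul_le_mul_of_nonneg_left (integral_kernel_mul_le hΩo hf hv hvs hvΩ hvf hd c) ha
  have hne : ∀ᵐ y ∂volume.restrict Ω, y ≠ x :=
    ae_restrict_of_ae (Measure.ae_ne volume x)
  calc ENNReal.ofReal (Real.exp
        ((a * ∫ y, 2 * c ^ 2 / (1 + c ^ 2 * ‖y - x‖ ^ 2) ^ 2 * v y) / F))
      ≤ ENNReal.ofReal ((∫ y in Ω, Real.exp (a * regLog c d x y) * |f y|) / F) := by
        refine ENNReal.ofReal_le_ofReal (le_trans (Real.exp_le_exp.2 ?_) hjensen)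
        gcongr
    _ = ∫⁻ y in Ω, ENNReal.ofReal (Real.exp (a * regLog c d x y) * |f y| / F) := by
        rw [← integral_div, ofReal_integral_eq_lintegral_ofReal (hexp.div_const F)]
        exact Filter.Eventually.of_forall fun y => by positivity
    _ ≤ _ := by
        refine lintegral_mono_ae ?_
        filter_upwards [hne, ae_restrict_mem hΩo.measurableSet] with y hyx hy
        have hr : 0 < ‖y - x‖ := norm_pos_iff.2 (sub_ne_zero.2 hyx)
        have hd0 : 0 < d := hr.trans_le (hd y hy)
        rw [← ENNReal.ofReal_mul (by positivity), mul_div_assoc]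
        gcongr
        exact exp_mul_regLog_le ha (hd y hy) hr

/-- Exponential bound on a solution of the Dirichlet problem by the potential of its data. -/
theorem ofReal_exp_solution_le_lintegral {Ω : Set (EuclideanSpace ℝ (Fin 2))} (hΩo : IsOpen Ω)
    (hΩb : Bornology.IsBounded Ω) {u f : EuclideanSpace ℝ (Fin 2) → ℝ}
    (hf : IntegrableOn f Ω) (hF : 0 < ∫ y in Ω, |f y|) (hu : ContDiffOn ℝ 2 u Ω)
    (hcont : ContinuousOn u (closure Ω)) (heq : ∀ x ∈ Ω, |lap2 u x| = |f x|)
    (hbd : ∀ x ∈ frontier Ω, u x = 0) {a d : ℝ} (ha : 0 ≤ a)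
    {x : EuclideanSpace ℝ (Fin 2)} (hx : x ∈ Ω) (hd : ∀ y ∈ Ω, ‖y - x‖ ≤ d) :
    ENNReal.ofReal (Real.exp (a * (2 * π * u x) / ∫ y in Ω, |f y|)) ≤
      ∫⁻ y in Ω, ENNReal.ofReal ((d / ‖y - x‖) ^ a)
        * ENNReal.ofReal (|f y| / ∫ z in Ω, |f z|) := by
  set F := ∫ y in Ω, |f y| with hFdef
  have hlim : Filter.Tendsto (fun ε : ℝ => ENNReal.ofReal
      (Real.exp (a * (2 * π * (u x - 2 * ε)) / F))) (nhdsWithin 0 (Set.Ioi 0))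
      (nhds (ENNReal.ofReal (Real.exp (a * (2 * π * (u x - 2 * 0)) / F)))) := by
    refine Filter.Tendsto.mono_left (Continuous.tendsto ?_ 0) nhdsWithin_le_nhds
    exact ENNReal.continuous_ofReal.comp (by fun_prop)
  rw [mul_zero, sub_zero] at hlim
  refine le_of_tendsto hlim ?_
  filter_upwards [self_mem_nhdsWithin] with ε hε
  obtain ⟨v, hv, hvs, hvΩ, hvf, hvu⟩ :=
    exists_compactly_supported_truncation hΩo hΩb hu hcont hbd hε
  refine le_trans (ENNReal.ofReal_le_ofReal (Real.exp_le_exp.2 ?_))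
    (ofReal_exp_le_lintegral hΩo hf hF hv hvs hvΩ
      (fun y hy => (hvf y hy).trans_eq (heq y hy)) ha hd)
  have := Real.pi_pos
  gcongr
  exact hvu x hx

theorem lintegral_rpow_div_norm_sub_le {Ω : Set (EuclideanSpace ℝ (Fin 2))}
    (hΩ : MeasurableSet Ω) {a d : ℝ} (ha : a < 2) (hd0 : 0 < d)
    {y : EuclideanSpace ℝ (Fin 2)} (hd : ∀ x ∈ Ω, ‖y - x‖ ≤ d) :
    ∫⁻ x in Ω, ENNReal.ofReal ((d / ‖y - x‖) ^ a) ≤ ENNReal.ofReal (2 * π * d ^ 2 / (2 - a)) := by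
  have hrad : ∀ r ∈ Set.Ioc 0 d, r * (d / r) ^ a = d ^ a * r ^ (1 - a) := by
    intro r hr
    rw [Real.div_rpow hd0.le hr.1.le, Real.rpow_sub hr.1, Real.rpow_one]
    ring
  set h : ℝ → ℝ := (Set.Iic d).indicator fun r => (d / r) ^ a with hh
  have hind : Set.EqOn (fun r : ℝ => r ^ (2 - 1) • h r)
      ((Set.Ioc 0 d).indicator fun r => d ^ a * r ^ (1 - a)) (Set.Ioi 0) := by
    intro r hr
    by_cases hrd : r ≤ d
    · simp [hh, hrd, Set.mem_Ioi.1 hr, hrad r ⟨hr, hrd⟩]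
    · simp [hh, hrd]
  have hpow : IntegrableOn (fun r : ℝ => d ^ a * r ^ (1 - a)) (Set.Ioc 0 d) := by
    rw [← intervalIntegrable_iff_integrableOn_Ioc_of_le hd0.le]
    exact (intervalIntegral.intervalIntegrable_rpow' (by linarith)).const_mul _
  have hint : Integrable (fun z : EuclideanSpace ℝ (Fin 2) => h ‖z‖) := by
    rw [integrable_fun_norm_addHaar volume]
    simp only [finrank_euclideanSpace, Fintype.card_fin]
    rw [integrableOn_congr_fun hind measurableSet_Ioi]
    exact (hpow.integrable_indicator measurableSet_Ioc).integrableOn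
  have hval : ∫ z : EuclideanSpace ℝ (Fin 2), h ‖z‖ = 2 * π * d ^ 2 / (2 - a) := by
    rw [integral_fun_norm_addHaar volume h, volume_real_unit_ball_fin_two]
    simp only [finrank_euclideanSpace, Fintype.card_fin]
    rw [setIntegral_congr_fun measurableSet_Ioi hind, setIntegral_indicator measurableSet_Ioc,
      Set.inter_eq_right.2 Set.Ioc_subset_Ioi_self, integral_const_mul,
      ← intervalIntegral.integral_of_le hd0.le, integral_rpow (Or.inl (by linarith)),
      Real.zero_rpow (by linarith), show 1 - a + 1 = 2 - a by ring, Real.rpow_sub hd0,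
      Real.rpow_two]
    have h1 : d ^ a ≠ 0 := (Real.rpow_pos_of_pos hd0 a).ne'
    have h2 : 2 - a ≠ 0 := by linarith
    simp only [smul_eq_mul, nsmul_eq_mul]
    field_simp
    norm_num [mul_comm]
  have hh0 : ∀ z : EuclideanSpace ℝ (Fin 2), 0 ≤ h ‖z‖ := fun z =>
    Set.indicator_apply_nonneg fun _ => by positivity
  calc ∫⁻ x in Ω, ENNReal.ofReal ((d / ‖y - x‖) ^ a)
      ≤ ∫⁻ x in Ω, ENNReal.ofReal (h ‖y - x‖) := by
        refine setLIntegral_mono' hΩ fun x hx => ?_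
        rw [hh, Set.indicator_of_mem (Set.mem_Iic.2 (hd x hx))]
    _ ≤ ∫⁻ x, ENNReal.ofReal (h ‖y - x‖) := setLIntegral_le_lintegral _ _
    _ = ∫⁻ z : EuclideanSpace ℝ (Fin 2), ENNReal.ofReal (h ‖z‖) :=
        lintegral_sub_left_eq_self (fun z => ENNReal.ofReal (h ‖z‖)) y
    _ = ENNReal.ofReal (2 * π * d ^ 2 / (2 - a)) := by
        rw [← hval, ofReal_integral_eq_lintegral_ofReal hint (Filter.Eventually.of_forall hh0)]

theorem volume_real_le_pi_mul_diam_sq {Ω : Set (EuclideanSpace ℝ (Fin 2))}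
    (hΩb : Bornology.IsBounded Ω) (hΩn : Ω.Nonempty) :
    volume.real Ω ≤ π * Metric.diam Ω ^ 2 := by
  obtain ⟨x, hx⟩ := hΩn
  have hsub : Ω ⊆ Metric.closedBall x (Metric.diam Ω) := fun y hy =>
    Metric.dist_le_diam_of_mem hΩb hy hx
  calc volume.real Ω ≤ volume.real (Metric.closedBall x (Metric.diam Ω)) :=
        measureReal_mono hsub measure_closedBall_lt_top.ne
    _ = π * Metric.diam Ω ^ 2 := by
        rw [Measure.real, EuclideanSpace.volume_closedBall_fin_two, ENNReal.toReal_mul,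
          ENNReal.toReal_pow, ENNReal.toReal_ofReal Metric.diam_nonneg,
          ENNReal.toReal_ofReal Real.pi_pos.le, mul_comm]

/-- The Brezis–Merle inequality: if `-Δu = f` in a bounded domain `Ω ⊂ ℝ²` with `u = 0`
on `∂Ω` and `f ∈ L¹(Ω)`, then for every `δ ∈ (0, 4π)`,
`∫_Ω exp((4π-δ)|u|/‖f‖₁) ≤ (4π²/δ)(diam Ω)²`. -/
theorem brezis_merle (Ω : Set (EuclideanSpace ℝ (Fin 2))) (hΩo : IsOpen Ω)
    (hΩb : Bornology.IsBounded Ω) (hΩc : IsConnected Ω)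
    (u f : EuclideanSpace ℝ (Fin 2) → ℝ)
    (hf : IntegrableOn f Ω) (hu : ContDiffOn ℝ 2 u Ω)
    (hcont : ContinuousOn u (closure Ω))
    (heq : ∀ x ∈ Ω, -lap2 u x = f x)
    (hbd : ∀ x ∈ frontier Ω, u x = 0)
    (δ : ℝ) (hδ : δ ∈ Set.Ioo 0 (4 * π)) :
    ∫ x in Ω, Real.exp ((4 * π - δ) * |u x| / (∫ y in Ω, |f y|))
      ≤ (4 * π ^ 2 / δ) * (Metric.diam Ω) ^ 2 := by
  have hπ := Real.pi_pos
  obtain ⟨hδ0, hδ4⟩ := hδ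
  set F := ∫ y in Ω, |f y| with hFdef
  have hF0 : 0 ≤ F := integral_nonneg fun y => abs_nonneg (f y)
  rcases hF0.eq_or_lt with hF | hF
  · have hconst : π ≤ 4 * π ^ 2 / δ := by
      rw [le_div_iff₀ hδ0]
      nlinarith
    simp only [← hF, div_zero, Real.exp_zero, setIntegral_const, smul_eq_mul, mul_one]
    exact (volume_real_le_pi_mul_diam_sq hΩb hΩc.nonempty).trans
      (mul_le_mul_of_nonneg_right hconst (sq_nonneg _))
  have hdist : ∀ x ∈ Ω, ∀ y ∈ Ω, ‖y - x‖ ≤ Metric.diam Ω := fun x hx y hy => by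
    rw [← dist_eq_norm]
    exact Metric.dist_le_diam_of_mem hΩb hy hx
  set d := Metric.diam Ω with hd
  have hd0 : 0 < d := by
    obtain ⟨x, hx⟩ := hΩc.nonempty
    exact Metric.diam_pos (infinite_of_mem_nhds x (hΩo.mem_nhds hx)).nontrivial hΩb
  set a := (4 * π - δ) / (2 * π) with hadef
  have ha : a * (2 * π) = 4 * π - δ := div_mul_cancel₀ _ (by positivity)
  have ha0 : 0 ≤ a := div_nonneg (by linarith) (by positivity)
  have ha2 : 2 - a = δ / (2 * π) := by
    rw [hadef]
    field_simp
    ring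
  have hpoint : ∀ x ∈ Ω, ENNReal.ofReal (Real.exp ((4 * π - δ) * |u x| / F)) ≤
      ∫⁻ y in Ω, ENNReal.ofReal ((d / ‖y - x‖) ^ a) * ENNReal.ofReal (|f y| / F) := by
    intro x hx
    rw [← ha, mul_assoc]
    rcases abs_choice (u x) with h | h <;> rw [h]
    · exact ofReal_exp_solution_le_lintegral hΩo hΩb hf hF hu hcont
        (fun y hy => by rw [← heq y hy, abs_neg]) hbd ha0 hx (hdist x hx)
    · exact ofReal_exp_solution_le_lintegral (u := -u) hΩo hΩb hf hF hu.neg hcont.neg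
        (fun y hy => by rw [lap2_neg, heq y hy]) (fun y hy => by simp [hbd y hy]) ha0 hx
        (hdist x hx)
  have hmeas : AEMeasurable (Function.uncurry fun x y : EuclideanSpace ℝ (Fin 2) =>
      ENNReal.ofReal ((d / ‖y - x‖) ^ a) * ENNReal.ofReal (|f y| / F))
      ((volume.restrict Ω).prod (volume.restrict Ω)) := by
    have hfm : AEMeasurable (fun y => ENNReal.ofReal (|f y| / F)) (volume.restrict Ω) :=
      (hf.abs.aemeasurable.div_const F).ennreal_ofReal
    have hkm : Measurable fun p : EuclideanSpace ℝ (Fin 2) × EuclideanSpace ℝ (Fin 2) =>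
        ENNReal.ofReal ((d / ‖p.2 - p.1‖) ^ a) := by fun_prop
    exact hkm.aemeasurable.mul hfm.comp_snd
  have hmass : ∫⁻ y in Ω, ENNReal.ofReal (|f y| / F) = 1 := by
    rw [← ofReal_integral_eq_lintegral_ofReal (hf.abs.div_const F)
      (Filter.Eventually.of_forall fun y => by positivity), integral_div, div_self hF.ne',
      ENNReal.ofReal_one]
  have hbound : ∫⁻ x in Ω, ENNReal.ofReal (Real.exp ((4 * π - δ) * |u x| / F)) ≤
      ENNReal.ofReal (4 * π ^ 2 / δ * d ^ 2) :=
    calc ∫⁻ x in Ω, ENNReal.ofReal (Real.exp ((4 * π - δ) * |u x| / F))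
        ≤ ∫⁻ x in Ω, ∫⁻ y in Ω,
            ENNReal.ofReal ((d / ‖y - x‖) ^ a) * ENNReal.ofReal (|f y| / F) :=
          setLIntegral_mono' hΩo.measurableSet hpoint
      _ = ∫⁻ y in Ω, ∫⁻ x in Ω,
            ENNReal.ofReal ((d / ‖y - x‖) ^ a) * ENNReal.ofReal (|f y| / F) :=
          lintegral_lintegral_swap hmeas
      _ ≤ ∫⁻ y in Ω, ENNReal.ofReal (2 * π * d ^ 2 / (2 - a)) * ENNReal.ofReal (|f y| / F) := by
          refine setLIntegral_mono' hΩo.measurableSet fun y hy => ?_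
          rw [lintegral_mul_const' _ _ ENNReal.ofReal_ne_top]
          gcongr
          exact lintegral_rpow_div_norm_sub_le hΩo.measurableSet
            (sub_pos.1 (ha2 ▸ by positivity)) hd0 fun x hx => hdist x hx y hy
      _ = ENNReal.ofReal (4 * π ^ 2 / δ * d ^ 2) := by
          rw [lintegral_const_mul' _ _ ENNReal.ofReal_ne_top, hmass, mul_one, ha2]
          congr 1
          field_simp
          ring
  have hcontΩ : ContinuousOn u Ω := hcont.mono subset_closure
  rw [integral_eq_lintegral_of_nonneg_ae (Filter.Eventually.of_forall fun x => (Real.exp_pos _).le)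
    (ContinuousOn.aestronglyMeasurable (by fun_prop) hΩo.measurableSet)]
  exact ENNReal.toReal_le_of_le_ofReal (by positivity) hbound
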